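/- arXiv:2001.00327 — 8 statements merged into one kernel-verified Lean document; each statement's English description precedes it below -/
import Mathlib

section
/- Let n ≥ 1, let k > ℓ ≥ 1 be integers, let c ≥ 2, and let C ⊆ ZMod n be the image of {0, 1, ..., c-1}. Then every nonempty C-(k,ℓ)-sum-free subset A of ZMod n satisfies (as integers) |A| ≤ ⌊(n + 2(c-2))/(k+ℓ)⌋ - (c-2). -/
open Finset Pointwise

/-- The `k`-fold Minkowski sum `kA = A + ⋯ + A` (with `0A = {0}`). -/
def iterSum {n : ℕ} : ℕ → Finset (ZMod n) → Finset (ZMod n)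
  | 0, _ => {0}
  | j + 1, A => A + iterSum j A

/-- The noisy `k`-fold sum `k *_C A = kA + (k-1)C`. -/
def noisy {n : ℕ} (C : Finset (ZMod n)) (k : ℕ) (A : Finset (ZMod n)) :
    Finset (ZMod n) :=
  iterSum k A + iterSum (k - 1) C

/-- `A` is `C`-`(k,ℓ)`-sum-free: `(k *_C A) ∩ (ℓ *_C A) = ∅`. -/
def SumFree {n : ℕ} (C : Finset (ZMod n)) (k l : ℕ) (A : Finset (ZMod n)) : Prop :=
  noisy C k A ∩ noisy C l A = ∅

/-- `μ^C_{k,ℓ}(ZMod n)`: the maximum size of a `C`-`(k,ℓ)`-sum-free subset of `ZMod n`. -/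
noncomputable def mu (n : ℕ) (k l : ℕ) (C : Finset (ZMod n)) : ℕ :=
  sSup {m | ∃ A : Finset (ZMod n), SumFree C k l A ∧ A.card = m}

/-- The stabilizer `stab(X) = {g : g + X = X}` of a finite subset of `ZMod n`. -/
def stab {n : ℕ} (X : Finset (ZMod n)) : Set (ZMod n) :=
  {g | X.image (g + ·) = X}

lemma exists_mem_add_one_notMem {n : ℕ} [NeZero n] {A : Finset (ZMod n)} (hA : A.Nonempty)
    (hne : A ≠ univ) : ∃ a ∈ A, a + 1 ∉ A := by
  by_contra! h
  obtain ⟨a, ha⟩ := hA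
  have hcast (j : ℕ) : a + (j : ZMod n) ∈ A := by
    induction j with
    | zero => simpa using ha
    | succ j ih => simpa [add_assoc] using h _ ih
  refine hne (eq_univ_of_forall fun x => ?_)
  simpa using hcast (x - a).val

/-- A Kneser-type bound for `A + B + {0, 1}`, proved by the Dyson `e`-transform. -/
lemma min_card_add_card_le_card_add_add_pair {n : ℕ} [NeZero n] (A B : Finset (ZMod n))
    (hA : A.Nonempty) (hB : B.Nonempty) :
    min n (#A + #B) ≤ #(A + B + {0, 1}) := by
  induction hm : #B using Nat.strong_induction_on generalizing A B with
  | _ m ih =>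
  subst hm
  by_cases hstable : ∀ a ∈ A, ∀ b ∈ B, ∀ b' ∈ B, a - b + b' ∈ A
  · obtain ⟨b₀, hb₀⟩ := hB
    by_cases huniv : A = univ
    · subst huniv
      refine (min_le_left _ _).trans ?_
      calc n = #(univ : Finset (ZMod n)) := by rw [card_univ, ZMod.card]
        _ ≤ _ := (card_le_card_add_right ⟨b₀, hb₀⟩).trans (card_le_card_add_right (by simp))
    · obtain ⟨a, ha, ha1⟩ := exists_mem_add_one_notMem hA huniv
      have hdisj : Disjoint (A.image (· + b₀)) (B.image (a + 1 + ·)) := by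
        rw [disjoint_left]
        intro x hx hx'
        obtain ⟨a', ha', rfl⟩ := mem_image.1 hx
        obtain ⟨b, hb, hab⟩ := mem_image.1 hx'
        have heq : a + 1 = a' - b + b₀ := by linear_combination hab
        exact ha1 (heq ▸ hstable a' ha' b hb b₀ hb₀)
      have hsub : A.image (· + b₀) ∪ B.image (a + 1 + ·) ⊆ A + B + {0, 1} := by
        refine union_subset (image_subset_iff.2 fun a' ha' => ?_)
          (image_subset_iff.2 fun b hb => ?_)
        · simpa using add_mem_add (add_mem_add ha' hb₀) (mem_insert_self (0 : ZMod n) {1})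
        · have hmem := add_mem_add (add_mem_add ha hb)
            (mem_insert_of_mem (mem_singleton_self 1) : (1 : ZMod n) ∈ ({0, 1} : Finset (ZMod n)))
          rwa [add_right_comm a b 1] at hmem
      have hcard := card_le_card hsub
      rw [card_union_of_disjoint hdisj, card_image_of_injective _ (add_left_injective _),
        card_image_of_injective _ (add_right_injective _)] at hcard
      exact (min_le_right _ _).trans hcard
  · push Not at hstable
    obtain ⟨a, ha, b, hb, b', hb', hnot⟩ := hstable
    have hcard := addDysonETransform.card (a - b) (A, B)
    have hsub := addDysonETransform.subset (a - b) (A, B)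
    simp only [addDysonETransform] at hcard hsub
    have hlt : #(B ∩ (-(a - b) +ᵥ A)) < #B := by
      refine card_lt_card (ssubset_iff_of_subset inter_subset_left |>.2 ⟨b', hb', fun h => hnot ?_⟩)
      simpa only [mem_neg_vadd_finset_iff, vadd_eq_add] using (mem_inter.1 h).2
    rw [← hcard]
    refine (ih _ hlt _ _ (hA.mono subset_union_left) ⟨b, mem_inter.2 ⟨hb, ?_⟩⟩ rfl).trans
      (card_le_card (add_subset_add_right hsub))
    simpa only [mem_neg_vadd_finset_iff, vadd_eq_add, sub_add_cancel] using ha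

lemma min_card_le_card_add_add_interval {n : ℕ} [NeZero n] (A B : Finset (ZMod n))
    (hA : A.Nonempty) (hB : B.Nonempty) (m : ℕ) :
    min n (#A + #B + m) ≤ #(A + B + (range (m + 2)).image (Nat.cast : ℕ → ZMod n)) := by
  induction m with
  | zero => simpa [range_add_one, pair_comm] using min_card_add_card_le_card_add_add_pair A B hA hB
  | succ m ih =>
    set I := (range (m + 2)).image (Nat.cast : ℕ → ZMod n) with hI
    have hI₀ : I.Nonempty := by simp [hI]
    have hstep := min_card_add_card_le_card_add_add_pair (A + B + I) {0} ((hA.add hB).add hI₀)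
      (singleton_nonempty _)
    have hsub : I + {0, 1} ⊆ (range (m + 1 + 2)).image (Nat.cast : ℕ → ZMod n) := by
      intro x hx
      obtain ⟨y, hy, z, hz, rfl⟩ := mem_add.1 hx
      obtain ⟨j, hj, rfl⟩ := mem_image.1 hy
      rw [mem_range] at hj
      rcases mem_insert.1 hz with rfl | hz
      · exact mem_image.2 ⟨j, mem_range.2 (by omega), by simp⟩
      · rw [mem_singleton.1 hz]
        exact mem_image.2 ⟨j + 1, mem_range.2 (by omega), by simp⟩
    have hle := card_le_card (add_subset_add_left hsub (s := A + B))
    rw [singleton_zero, add_zero, card_zero, add_assoc (A + B)] at hstep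
    omega

lemma iterSum_nonempty {n : ℕ} {A : Finset (ZMod n)} (hA : A.Nonempty) (k : ℕ) :
    (iterSum k A).Nonempty := by
  induction k with
  | zero => simp [iterSum]
  | succ k ih => exact hA.add ih

lemma noisy_nonempty {n : ℕ} {A C : Finset (ZMod n)} (hA : A.Nonempty) (hC : C.Nonempty) (k : ℕ) :
    (noisy C k A).Nonempty :=
  (iterSum_nonempty hA _).add (iterSum_nonempty hC _)

lemma min_le_card_noisy_interval {n : ℕ} [NeZero n] {A : Finset (ZMod n)} (hA : A.Nonempty)
    (m k : ℕ) :
    min n ((k + 1) * #A + k * m) ≤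
      #(noisy ((range (m + 2)).image (Nat.cast : ℕ → ZMod n)) (k + 1) A) := by
  induction k with
  | zero => simp [noisy, iterSum]
  | succ k ih =>
    set C := (range (m + 2)).image (Nat.cast : ℕ → ZMod n) with hC
    have hC₀ : C.Nonempty := by simp [hC]
    have hsucc : noisy C (k + 1 + 1) A = noisy C (k + 1) A + A + C := by
      simp only [noisy, iterSum, Nat.add_sub_cancel]
      abel
    have hstep := min_card_le_card_add_add_interval (noisy C (k + 1) A) A
      (noisy_nonempty hA hC₀ _) hA m
    rw [← hC] at hstep
    rw [hsucc]
    have hexp : (k + 1 + 1) * #A + (k + 1) * m = ((k + 1) * #A + k * m) + #A + m := by ring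
    omega

theorem stmt0 (n : ℕ) [NeZero n] (k l c : ℕ) (hl : 1 ≤ l) (hkl : l < k) (hc : 2 ≤ c)
    (C : Finset (ZMod n)) (hC : C = (Finset.range c).image (Nat.cast : ℕ → ZMod n))
    (A : Finset (ZMod n)) (hA : A.Nonempty) (hfree : SumFree C k l A) :
    (A.card : ℤ) ≤ ((n : ℤ) + 2 * ((c : ℤ) - 2)) / ((k : ℤ) + (l : ℤ)) - ((c : ℤ) - 2) := by
  obtain ⟨m, rfl⟩ := Nat.exists_eq_add_of_le' hc
  obtain ⟨l, rfl⟩ := Nat.exists_eq_add_of_le' hl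
  obtain ⟨k, rfl⟩ := Nat.exists_eq_add_of_le' (hl.trans hkl.le)
  have hC₀ : C.Nonempty := by simp [hC]
  have hk := (noisy_nonempty hA hC₀ (k + 1)).card_pos
  have hl' := (noisy_nonempty hA hC₀ (l + 1)).card_pos
  have hdisj := card_union_of_disjoint (disjoint_iff_inter_eq_empty.2 hfree)
  have hn := card_le_univ (noisy C (k + 1) A ∪ noisy C (l + 1) A)
  rw [ZMod.card] at hn
  have hkC := min_le_card_noisy_interval hA m k
  have hlC := min_le_card_noisy_interval hA m l
  rw [← hC] at hkC hlC
  have hsum : ((k + 1) * #A + k * m) + ((l + 1) * #A + l * m) ≤ n := by omega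
  rw [le_sub_iff_add_le, Int.le_ediv_iff_mul_le (by positivity)]
  zify at hsum
  push_cast
  linarith
end

section
/- Let n ≥ 1, let k > ℓ ≥ 1 be integers, let c ≥ 2, and let C ⊆ ZMod n be the image of {0, 1, ..., c-1}. Set δ = gcd(n, k-ℓ) and let r be the remainder of -k·⌊(n + 2(c-2))/(k+ℓ)⌋ + (c-2) modulo δ. Then there exists a C-(k,ℓ)-sum-free subset A of ZMod n with (as integers) |A| ≥ ⌊(n + 2(c-2) - r)/(k+ℓ)⌋ - (c-2); in fact A can be taken to be an interval (the image in ZMod n of {a, a+1, ..., a+m-1} for some integers a and m). -/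
open Finset Pointwise

/-- If `A` lies in the image of the integer interval `[a, a + b]`, then `jA` lies in the image of
`[j * a, j * a + j * b]`. -/
theorem exists_int_of_mem_iterSum {n : ℕ} {A : Finset (ZMod n)} {a b : ℤ}
    (hA : ∀ x ∈ A, ∃ t : ℤ, 0 ≤ t ∧ t ≤ b ∧ x = ((a + t : ℤ) : ZMod n)) (j : ℕ) :
    ∀ x ∈ iterSum j A, ∃ t : ℤ, 0 ≤ t ∧ t ≤ j * b ∧ x = ((j * a + t : ℤ) : ZMod n) := by
  induction j with
  | zero =>
    intro x hx
    exact ⟨0, le_rfl, by simp, by simpa [iterSum] using hx⟩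
  | succ j ih =>
    intro x hx
    obtain ⟨y, hy, z, hz, rfl⟩ := Finset.mem_add.mp hx
    obtain ⟨t, ht0, htb, rfl⟩ := hA y hy
    obtain ⟨u, hu0, hub, rfl⟩ := ih z hz
    refine ⟨t + u, by lia, ?_, ?_⟩
    · push_cast
      linarith
    · push_cast
      ring

/-- The noisy sum of sets inside the images of `[a, a + b]` and `[0, e]`. -/
theorem exists_int_of_mem_noisy {n : ℕ} {A C : Finset (ZMod n)} {a b e : ℤ}
    (hA : ∀ x ∈ A, ∃ t : ℤ, 0 ≤ t ∧ t ≤ b ∧ x = ((a + t : ℤ) : ZMod n))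
    (hC : ∀ x ∈ C, ∃ t : ℤ, 0 ≤ t ∧ t ≤ e ∧ x = ((0 + t : ℤ) : ZMod n))
    {k : ℕ} (hk : 1 ≤ k) :
    ∀ x ∈ noisy C k A, ∃ t : ℤ, 0 ≤ t ∧ t ≤ k * b + (k - 1) * e ∧
      x = ((k * a + t : ℤ) : ZMod n) := by
  intro x hx
  obtain ⟨y, hy, z, hz, rfl⟩ := Finset.mem_add.mp hx
  obtain ⟨t, ht0, htb, rfl⟩ := exists_int_of_mem_iterSum hA k y hy
  obtain ⟨u, hu0, hub, rfl⟩ := exists_int_of_mem_iterSum hC (k - 1) z hz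
  rw [Nat.cast_sub hk, Nat.cast_one] at hub
  exact ⟨t + u, by lia, by linarith, by push_cast; ring⟩

/-- With `M = ⌊(N + 2d - r) / (k + l)⌋`, the interval `[l * M - d, N - k * M + d]` contains a
multiple of `δ`. -/
theorem exists_multiple_between {N k l d δ r M : ℤ} (hl : 1 ≤ l) (hkl : l < k)
    (hδ : 0 < δ) (hδN : δ ∣ N) (hδle : δ ≤ k - l)
    (hr : r = (-k * ((N + 2 * d) / (k + l)) + d) % δ) (hM : M = (N + 2 * d - r) / (k + l)) :
    ∃ q : ℤ, l * M - d ≤ δ * q ∧ δ * q ≤ N - k * M + d := by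
  set f := (N + 2 * d) / (k + l) with hf
  have hpos : 0 < k + l := by lia
  have hr0 : 0 ≤ r := hr ▸ Int.emod_nonneg _ hδ.ne'
  have hrlt : r < δ := hr ▸ Int.emod_lt_of_pos _ hδ
  have hM_mul : (k + l) * M ≤ N + 2 * d - r := hM ▸ Int.mul_ediv_self_le hpos.ne'
  have hf_mul : (k + l) * f ≤ N + 2 * d := Int.mul_ediv_self_le hpos.ne'
  have hMf : M ≤ f := hM ▸ Int.ediv_le_ediv hpos (by lia)
  rcases hMf.eq_or_lt with hMf | hMf
  · obtain ⟨w, hw⟩ := hδN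
    have hdiv := Int.mul_ediv_add_emod (-k * f + d) δ
    refine ⟨w + (-k * f + d) / δ, ?_, ?_⟩ <;> rw [mul_add, ← hw] <;> subst hMf <;> linarith
  · have hdiv := Int.mul_ediv_add_emod (N - k * M + d) δ
    have hmod := Int.emod_lt_of_pos (N - k * M + d) hδ
    have hmod0 := Int.emod_nonneg (N - k * M + d) hδ.ne'
    refine ⟨(N - k * M + d) / δ, ?_, by linarith⟩
    nlinarith

/-- A set inside the image of `[a, a + b]` is sum-free with respect to `C ⊆ [0, e]` as soon as
some `x ≡ (k - l) * a` modulo `n` separates the two noisy sums. -/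
theorem sumFree_of_separated {n : ℕ} {A C : Finset (ZMod n)} {a b e x : ℤ} {k l : ℕ}
    (hk : 1 ≤ k) (hl : 1 ≤ l)
    (hA : ∀ x ∈ A, ∃ t : ℤ, 0 ≤ t ∧ t ≤ b ∧ x = ((a + t : ℤ) : ZMod n))
    (hC : ∀ x ∈ C, ∃ t : ℤ, 0 ≤ t ∧ t ≤ e ∧ x = ((0 + t : ℤ) : ZMod n))
    (hx : (n : ℤ) ∣ (k - l) * a - x)
    (hlow : l * b + (l - 1) * e < x) (hupp : x + (k * b + (k - 1) * e) < n) :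
    SumFree C k l A := by
  refine Finset.eq_empty_of_forall_notMem fun y hy => ?_
  obtain ⟨hyk, hyl⟩ := Finset.mem_inter.mp hy
  obtain ⟨t, ht0, htb, hyt⟩ := exists_int_of_mem_noisy hA hC hk y hyk
  obtain ⟨u, hu0, hub, hyu⟩ := exists_int_of_mem_noisy hA hC hl y hyl
  have hdvd : (n : ℤ) ∣ (k * a + t) - (l * a + u) :=
    (ZMod.intCast_eq_intCast_iff_dvd_sub _ _ n).mp (hyu.symm.trans hyt)
  have hdvd' : (n : ℤ) ∣ x + t - u := by
    have := dvd_sub hdvd hx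
    ring_nf at this ⊢
    exact this
  have := Int.le_of_dvd (by linarith) hdvd'
  linarith

/-- An interval of length `m ≤ n` in `ZMod n` has `m` elements. -/
theorem card_image_add_range {n m : ℕ} (a : ZMod n) (hm : m ≤ n) :
    ((Finset.range m).image (fun i : ℕ => a + (i : ZMod n))).card = m := by
  rw [Finset.card_image_of_injOn, Finset.card_range]
  intro i hi j hj hij
  have hi' := Finset.mem_range.mp hi
  have hj' := Finset.mem_range.mp hj
  exact Nat.ModEq.eq_of_lt_of_lt ((ZMod.natCast_eq_natCast_iff _ _ _).mp (add_left_cancel hij))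
    (hi'.trans_le hm) (hj'.trans_le hm)

theorem stmt1 (n : ℕ) [NeZero n] (k l c : ℕ) (hl : 1 ≤ l) (hkl : l < k) (hc : 2 ≤ c)
    (C : Finset (ZMod n)) (hC : C = (Finset.range c).image (Nat.cast : ℕ → ZMod n))
    (δ r : ℤ) (hδ : δ = Int.gcd (n : ℤ) ((k : ℤ) - (l : ℤ)))
    (hr : r = (-(k : ℤ) * (((n : ℤ) + 2 * ((c : ℤ) - 2)) / ((k : ℤ) + (l : ℤ)))
        + ((c : ℤ) - 2)) % δ) :
    ∃ (A : Finset (ZMod n)) (a : ℤ) (m : ℕ),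
      A = (Finset.range m).image (fun i : ℕ => (a : ZMod n) + (i : ZMod n)) ∧
      SumFree C k l A ∧
      ((n : ℤ) + 2 * ((c : ℤ) - 2) - r) / ((k : ℤ) + (l : ℤ)) - ((c : ℤ) - 2)
        ≤ (A.card : ℤ) := by
  have hn : 0 < n := NeZero.pos n
  have hδpos : 0 < δ := by
    rw [hδ]
    exact_mod_cast Int.gcd_pos_of_ne_zero_left _ (by exact_mod_cast hn.ne')
  have hδn : δ ∣ n := hδ ▸ Int.gcd_dvd_left _ _
  have hδle : δ ≤ (k : ℤ) - l := Int.le_of_dvd (by lia) (hδ ▸ Int.gcd_dvd_right _ _)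
  have hr0 : 0 ≤ r := hr ▸ Int.emod_nonneg _ hδpos.ne'
  obtain ⟨M, hM⟩ : ∃ M, M = ((n : ℤ) + 2 * ((c : ℤ) - 2) - r) / ((k : ℤ) + (l : ℤ)) := ⟨_, rfl⟩
  rw [← hM]
  by_cases hpos : M - ((c : ℤ) - 2) ≤ 0
  · obtain ⟨k, rfl⟩ : ∃ j, k = j + 1 := ⟨k - 1, by lia⟩
    exact ⟨∅, 0, 0, by simp, by simp [SumFree, noisy, iterSum], by simpa using hpos⟩
  · obtain ⟨m, hm⟩ := Int.eq_ofNat_of_zero_le (not_le.mp hpos).le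
    obtain ⟨q, hq1, hq2⟩ := exists_multiple_between (by exact_mod_cast hl) (by exact_mod_cast hkl)
      hδpos hδn hδle hr hM
    have hm1 : (1 : ℤ) ≤ m := by lia
    have hMm : M = m + (c - 2) := by lia
    have hmn : m ≤ n := by
      have hc' : (0 : ℤ) ≤ c - 2 := by lia
      have hkl3 : (0 : ℤ) ≤ k + l - 3 := by lia
      have : (m : ℤ) ≤ n := by
        subst hMm
        nlinarith [mul_nonneg hkl3 (by lia : (0 : ℤ) ≤ m + (c - 2))]
      exact_mod_cast this
    set a : ℤ := Int.gcdB n ((k : ℤ) - l) * q with ha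
    refine ⟨_, a, m, rfl, ?_, ?_⟩
    · refine sumFree_of_separated (a := a) (b := m - 1) (e := c - 1) (x := δ * q)
        (hl.trans hkl.le) hl ?_ ?_ ?_ ?_ ?_
      · intro x hx
        obtain ⟨i, hi, rfl⟩ := Finset.mem_image.mp hx
        have := Finset.mem_range.mp hi
        exact ⟨i, by lia, by lia, by push_cast; rfl⟩
      · intro x hx
        obtain ⟨i, hi, rfl⟩ := Finset.mem_image.mp (hC ▸ hx)
        have := Finset.mem_range.mp hi
        exact ⟨i, by lia, by lia, by simp⟩
      · refine ⟨-(Int.gcdA n ((k : ℤ) - l) * q), ?_⟩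
        rw [hδ, Int.gcd_eq_gcd_ab, ha]
        ring
      · subst hMm
        linarith
      · subst hMm
        linarith
    · rw [card_image_add_range _ hmn, hm]
end

section
/- Let n ≥ 1 and let k > ℓ ≥ 1 be integers. Then every {0,1}-(k,ℓ)-sum-free subset A of ZMod n satisfies |A| ≤ ⌊n/(k+ℓ)⌋, where {0,1} denotes the image of {0, 1} ⊆ ℤ in ZMod n. -/
open Finset Pointwise

/-- A nonempty subset of `ZMod n` that is closed under adding `1` is everything. -/
lemma eq_univ_of_add_one_mem {n : ℕ} [NeZero n] {X : Finset (ZMod n)} (hX : X.Nonempty)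
    (h : ∀ x ∈ X, x + 1 ∈ X) : X = univ := by
  obtain ⟨x, hx⟩ := hX
  have hadd : ∀ m : ℕ, x + m ∈ X := by
    intro m
    induction m with
    | zero => simpa using hx
    | succ m ih => simpa [add_assoc] using h _ ih
  refine eq_univ_iff_forall.2 fun y => ?_
  simpa using hadd (y - x).val

/-- A Cauchy-Davenport type bound, valid for every modulus: adding the noise `{0, 1}` to a sumset
prevents it from being small. -/
lemma min_le_card_add_add {n : ℕ} [NeZero n] {X A : Finset (ZMod n)} (hX : X.Nonempty)
    (hA : A.Nonempty) : min n (#X + #A) ≤ #(X + A + {0, 1}) := by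
  induction hm : #A using Nat.strong_induction_on generalizing X A with
  | _ m ih =>
  subst hm
  by_cases hstab : ∀ x ∈ X, ∀ a ∈ A, ∀ b ∈ A, b + (x - a) ∈ X
  · obtain ⟨a, ha⟩ := hA
    by_cases hone : ∀ x ∈ X, x + 1 ∈ X
    · have huniv := eq_univ_of_add_one_mem hX hone
      have hcard : #X ≤ #(X + A + {0, 1}) :=
        (card_le_card_add_right ⟨a, ha⟩).trans (card_le_card_add_right (by simp))
      rw [huniv, card_univ, ZMod.card] at hcard
      exact (min_le_left _ _).trans (huniv ▸ hcard)
    · push Not at hone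
      obtain ⟨x, hx, hx1⟩ := hone
      have hdisj : Disjoint (X.image (· + a)) (A.image (x + 1 + ·)) := by
        simp only [disjoint_left, mem_image, not_exists, not_and]
        rintro _ ⟨y, hy, rfl⟩ b hb hab
        refine hx1 ?_
        have := hstab y hy b hb a ha
        rwa [show a + (y - b) = x + 1 by linear_combination -hab] at this
      have hsub : X.image (· + a) ∪ A.image (x + 1 + ·) ⊆ X + A + {0, 1} := by
        refine union_subset ?_ ?_ <;> refine image_subset_iff.2 fun y hy => ?_
        · simpa using add_mem_add (add_mem_add hy ha)
            (show (0 : ZMod n) ∈ ({0, 1} : Finset (ZMod n)) by simp)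
        · rw [add_right_comm x 1 y]
          exact add_mem_add (add_mem_add hx hy) (by simp)
      have hcard := card_le_card hsub
      rw [card_union_of_disjoint hdisj, card_image_of_injective _ (add_left_injective a),
        card_image_of_injective _ (add_right_injective (x + 1))] at hcard
      exact (min_le_right _ _).trans hcard
  · push Not at hstab
    obtain ⟨x, hx, a, ha, b, hb, hbx⟩ := hstab
    -- The Dyson transform of `(X, A)` at `x - a` keeps the total size and shrinks `A`.
    set e := addDysonETransform (x - a) (X, A) with he
    have hmem : ∀ c, c ∈ e.2 ↔ c ∈ A ∧ c + (x - a) ∈ X := by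
      intro c
      rw [he, addDysonETransform, mem_inter, mem_neg_vadd_finset_iff, vadd_eq_add, add_comm]
    have hne : e.2.Nonempty := ⟨a, (hmem a).2 ⟨ha, by simpa using hx⟩⟩
    have hlt : #e.2 < #A := card_lt_card <| ssubset_iff_of_subset (fun c hc => ((hmem c).1 hc).1)
      |>.2 ⟨b, hb, fun h => hbx ((hmem b).1 h).2⟩
    have hcard : #e.1 + #e.2 = #X + #A := addDysonETransform.card _ (X, A)
    have hne' : e.1.Nonempty := hX.mono subset_union_left
    have hsub : e.1 + e.2 ⊆ X + A := addDysonETransform.subset _ (X, A)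
    calc min n (#X + #A) = min n (#e.1 + #e.2) := by rw [hcard]
      _ ≤ #(e.1 + e.2 + {0, 1}) := ih _ hlt hne' hne rfl
      _ ≤ #(X + A + {0, 1}) := card_le_card (add_subset_add_right hsub)

lemma noisy_succ_succ {n : ℕ} (C : Finset (ZMod n)) (j : ℕ) (A : Finset (ZMod n)) :
    noisy C (j + 2) A = noisy C (j + 1) A + A + C := by
  simp only [noisy, iterSum, Nat.add_sub_cancel, show j + 2 - 1 = j + 1 from rfl]
  abel

lemma noisy_nonempty_and_min_le_card {n : ℕ} [NeZero n] {A : Finset (ZMod n)}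
    (hA : A.Nonempty) (j : ℕ) :
    (noisy {0, 1} (j + 1) A).Nonempty ∧
      min n ((j + 1) * #A) ≤ #(noisy {0, 1} (j + 1) A) := by
  induction j with
  | zero => simp [noisy, iterSum, hA]
  | succ j ih =>
    rw [noisy_succ_succ]
    refine ⟨(ih.1.add hA).add (by simp), le_trans ?_ (min_le_card_add_add ih.1 hA)⟩
    have := ih.2
    rw [add_one_mul]
    omega

theorem stmt2 (n : ℕ) [NeZero n] (k l : ℕ) (hl : 1 ≤ l) (hkl : l < k)
    (A : Finset (ZMod n)) (hfree : SumFree ({0, 1} : Finset (ZMod n)) k l A) :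
    A.card ≤ n / (k + l) := by
  rcases A.eq_empty_or_nonempty with rfl | hA
  · simp
  obtain ⟨i, rfl⟩ : ∃ i, k = i + 1 := ⟨k - 1, by omega⟩
  obtain ⟨j, rfl⟩ : ∃ j, l = j + 1 := ⟨l - 1, by omega⟩
  obtain ⟨hk, hk'⟩ := noisy_nonempty_and_min_le_card hA i
  obtain ⟨hl, hl'⟩ := noisy_nonempty_and_min_le_card hA j
  have hcard := card_le_univ (noisy {0, 1} (i + 1) A ∪ noisy {0, 1} (j + 1) A)
  rw [card_union_of_disjoint (disjoint_iff_inter_eq_empty.2 hfree), ZMod.card] at hcard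
  have := hk.card_pos
  have := hl.card_pos
  rw [Nat.le_div_iff_mul_le (by omega), mul_comm, add_mul]
  omega
end

section
/- Let n ≥ 1, let k > ℓ ≥ 1 be integers, let s be an integer with 0 < s, and let e be a positive divisor of gcd(s, n). Then μ^{{0,s}}_{k,ℓ}(ZMod n) ≥ μ_{k,ℓ}(ZMod e) · (n/e), where {0,s} is the image of {0, s} ⊆ ℤ in ZMod n. -/
open Finset Pointwise

/-- A homomorphism mapping `A` into `B` maps `jA` into `jB`. -/
lemma map_mem_iterSum {n e : ℕ} (f : ZMod n →+ ZMod e) {A : Finset (ZMod n)}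
    {B : Finset (ZMod e)} (hAB : ∀ x ∈ A, f x ∈ B) (j : ℕ) :
    ∀ x ∈ iterSum j A, f x ∈ iterSum j B := by
  induction j with
  | zero => simp [iterSum]
  | succ j ih =>
    intro x hx
    obtain ⟨a, ha, b, hb, rfl⟩ := Finset.mem_add.mp hx
    rw [map_add]
    exact Finset.add_mem_add (hAB a ha) (ih b hb)

/-- Preimages of sum-free sets are sum-free. -/
lemma SumFree.of_map {n e : ℕ} (f : ZMod n →+ ZMod e) {k l : ℕ} {A C : Finset (ZMod n)}
    {B D : Finset (ZMod e)} (hAB : ∀ x ∈ A, f x ∈ B) (hCD : ∀ x ∈ C, f x ∈ D)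
    (hB : SumFree D k l B) : SumFree C k l A := by
  have map_mem_noisy (j : ℕ) : ∀ x ∈ noisy C j A, f x ∈ noisy D j B := by
    intro x hx
    obtain ⟨a, ha, c, hc, rfl⟩ := Finset.mem_add.mp hx
    rw [map_add]
    exact Finset.add_mem_add (map_mem_iterSum f hAB j a ha) (map_mem_iterSum f hCD _ c hc)
  refine Finset.eq_empty_of_forall_notMem fun x hx => ?_
  obtain ⟨hk, hl⟩ := Finset.mem_inter.mp hx
  have hfx := Finset.mem_inter.mpr ⟨map_mem_noisy k x hk, map_mem_noisy l x hl⟩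
  rw [SumFree] at hB
  simp [hB] at hfx

lemma bddAbove_card_sumFree {n : ℕ} [NeZero n] (k l : ℕ) (C : Finset (ZMod n)) :
    BddAbove {m | ∃ A : Finset (ZMod n), SumFree C k l A ∧ A.card = m} := by
  refine ⟨Fintype.card (ZMod n), ?_⟩
  rintro m ⟨A, -, rfl⟩
  exact Finset.card_le_univ A

lemma SumFree.card_le_mu {n : ℕ} [NeZero n] {k l : ℕ} {C A : Finset (ZMod n)}
    (hA : SumFree C k l A) : A.card ≤ mu n k l C :=
  le_csSup (bddAbove_card_sumFree k l C) ⟨A, hA, rfl⟩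

lemma exists_sumFree_card_eq_mu {n : ℕ} [NeZero n] {k l : ℕ} (hk : k ≠ 0)
    (C : Finset (ZMod n)) : ∃ A : Finset (ZMod n), SumFree C k l A ∧ A.card = mu n k l C := by
  have hempty : SumFree C k l ∅ := by
    obtain ⟨j, rfl⟩ := Nat.exists_eq_succ_of_ne_zero hk
    simp [SumFree, noisy, iterSum]
  have hne : {m | ∃ A : Finset (ZMod n), SumFree C k l A ∧ A.card = m}.Nonempty :=
    ⟨0, ∅, hempty, rfl⟩
  exact Nat.sSup_mem hne (bddAbove_card_sumFree k l C)

/-- The preimage of `B` under reduction `ZMod n → ZMod e` has `|B| * (n / e)` elements. -/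
lemma card_filter_castHom_mem {n e : ℕ} [NeZero n] [NeZero e] (hen : e ∣ n)
    (B : Finset (ZMod e)) :
    #{x : ZMod n | ZMod.castHom hen (ZMod e) x ∈ B} = #B * (n / e) := by
  set f := ZMod.castHom hen (ZMod e)
  have hsurj : Function.Surjective f := ZMod.castHom_surjective hen
  have hfib (y : ZMod e) : #{x : ZMod n | f x = y} = #{x : ZMod n | f x = 0} :=
    AddMonoidHom.card_fiber_eq_of_mem_range f.toAddMonoidHom (hsurj y) (hsurj 0)
  have hpre (S : Finset (ZMod e)) :
      #{x : ZMod n | f x ∈ S} = #S * #{x : ZMod n | f x = 0} := by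
    rw [Finset.card_eq_sum_card_fiberwise (f := f) (t := S) (fun x hx => by simpa using hx),
      ← smul_eq_mul, ← Finset.sum_const]
    refine Finset.sum_congr rfl fun y hy => ?_
    rw [← hfib y, Finset.filter_filter]
    congr 1
    ext x
    simp only [Finset.mem_filter, Finset.mem_univ, true_and, and_iff_right_iff_imp]
    rintro rfl
    exact hy
  have hn : n = e * #{x : ZMod n | f x = 0} := by
    simpa [ZMod.card] using hpre Finset.univ
  rw [hpre B]
  congr 1
  exact (Nat.div_eq_of_eq_mul_right (NeZero.pos e) hn).symm

theorem stmt8 (n : ℕ) [NeZero n] (k l s : ℕ) (hl : 1 ≤ l) (hkl : l < k) (hs : 0 < s)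
    (e : ℕ) (he : 0 < e) (hed : e ∣ Nat.gcd s n) :
    mu e k l ({0} : Finset (ZMod e)) * (n / e) ≤
      mu n k l ({0, (s : ZMod n)} : Finset (ZMod n)) := by
  have : NeZero e := ⟨he.ne'⟩
  have hes : e ∣ s := hed.trans (Nat.gcd_dvd_left s n)
  have hen : e ∣ n := hed.trans (Nat.gcd_dvd_right s n)
  obtain ⟨B, hB, hcard⟩ :=
    exists_sumFree_card_eq_mu (l := l) (Nat.ne_of_gt (Nat.zero_lt_of_lt hkl)) ({0} : Finset (ZMod e))
  rw [← hcard, ← card_filter_castHom_mem hen B]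
  refine SumFree.card_le_mu
    (hB.of_map (ZMod.castHom hen (ZMod e)).toAddMonoidHom (fun x hx => ?_) fun x hx => ?_)
  · exact (Finset.mem_filter.mp hx).2
  · have hs0 : (s : ZMod e) = 0 := (ZMod.natCast_eq_zero_iff s e).mpr hes
    obtain rfl | rfl : x = 0 ∨ x = s := by simpa using hx
    · simp
    · rw [Finset.mem_singleton]
      exact (map_natCast (ZMod.castHom hen (ZMod e)) s).trans hs0
end

section
/- Let n ≥ 1, let k > ℓ ≥ 1 be integers, and let s ≥ 1 be an integer. Set δ = gcd(n, k-ℓ) and let r be the remainder of -k·⌊(n + 2(s-1))/(k+ℓ)⌋ + (s-1) modulo δ. Then there exists a {0,s}-(k,ℓ)-sum-free subset A of ZMod n with (as integers) |A| ≥ ⌊(n + 2(s-1) - r)/(k+ℓ)⌋ - (s-1), where {0,s} is the image of {0, s} ⊆ ℤ in ZMod n. -/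
open Finset Pointwise

/-- If every element of `A` lifts to an integer in `[a, b]`, then every element of `jA` lifts to an
integer in `[j * a, j * b]`. -/
theorem exists_lift_of_mem_iterSum {n : ℕ} {A : Finset (ZMod n)} {a b : ℤ}
    (hA : ∀ y ∈ A, ∃ x : ℤ, a ≤ x ∧ x ≤ b ∧ (x : ZMod n) = y) (j : ℕ) :
    ∀ y ∈ iterSum j A, ∃ x : ℤ, j * a ≤ x ∧ x ≤ j * b ∧ (x : ZMod n) = y := by
  induction j with
  | zero =>
    intro y hy
    rw [iterSum, Finset.mem_singleton] at hy
    exact ⟨0, by simp, by simp, by simp [hy]⟩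
  | succ j ih =>
    intro y hy
    rw [iterSum, Finset.mem_add] at hy
    obtain ⟨u, hu, v, hv, rfl⟩ := hy
    obtain ⟨p, hap, hpb, rfl⟩ := hA u hu
    obtain ⟨q, haq, hqb, rfl⟩ := ih v hv
    refine ⟨p + q, ?_, ?_, by push_cast; rfl⟩ <;> push_cast <;> linarith

/-- If every element of `A` lifts to an integer in `[a, b]`, then every element of
`j *_{0,s} A` lifts to an integer in `[j * a, j * b + (j - 1) * s]`. -/
theorem exists_lift_of_mem_noisy {n : ℕ} {A : Finset (ZMod n)} {a b : ℤ} (s : ℕ)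
    (hA : ∀ y ∈ A, ∃ x : ℤ, a ≤ x ∧ x ≤ b ∧ (x : ZMod n) = y) {j : ℕ} (hj : 1 ≤ j) :
    ∀ y ∈ noisy {0, (s : ZMod n)} j A,
      ∃ x : ℤ, j * a ≤ x ∧ x ≤ j * b + (j - 1) * s ∧ (x : ZMod n) = y := by
  intro y hy
  rw [noisy, Finset.mem_add] at hy
  obtain ⟨u, hu, v, hv, rfl⟩ := hy
  have hC : ∀ y ∈ ({0, (s : ZMod n)} : Finset (ZMod n)),
      ∃ x : ℤ, 0 ≤ x ∧ x ≤ (s : ℤ) ∧ (x : ZMod n) = y := by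
    intro y hy
    rw [Finset.mem_insert, Finset.mem_singleton] at hy
    rcases hy with rfl | rfl
    · exact ⟨0, le_rfl, by positivity, by simp⟩
    · exact ⟨s, by positivity, le_rfl, by simp⟩
  obtain ⟨p, hap, hpb, rfl⟩ := exists_lift_of_mem_iterSum hA j u hu
  obtain ⟨q, haq, hqb, rfl⟩ := exists_lift_of_mem_iterSum hC (j - 1) v hv
  rw [Nat.cast_sub hj, Nat.cast_one] at hqb
  exact ⟨p + q, by linarith, by linarith, by push_cast; rfl⟩

theorem sumFree_empty {n : ℕ} (C : Finset (ZMod n)) {k : ℕ} (l : ℕ) (hk : 1 ≤ k) :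
    SumFree C k l ∅ := by
  obtain ⟨j, rfl⟩ := Nat.exists_eq_add_of_le' hk
  simp [SumFree, noisy, iterSum]

/-- The image of an integer interval of length `m ≤ n` in `ZMod n` has `m` elements. -/
theorem card_image_intCast_Ico {n m : ℕ} (a : ℤ) (hm : m ≤ n) :
    ((Finset.Ico a (a + m)).image (Int.cast : ℤ → ZMod n)).card = m := by
  rw [Finset.card_image_of_injOn, Int.card_Ico]
  · simp
  · intro x hx y hy hxy
    rw [Finset.mem_coe, Finset.mem_Ico] at hx hy
    have hdvd := (ZMod.intCast_eq_intCast_iff_dvd_sub x y n).1 hxy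
    have := Int.eq_zero_of_abs_lt_dvd hdvd (by rw [abs_lt]; constructor <;> omega)
    omega

/-- An interval of length `m` starting at `a` is `{0,s}`-`(k,l)`-sum-free as soon as `(k - l) * a`
is congruent to some `x` at distance from the multiples of `n` exceeding the spread of the sums. -/
theorem sumFree_image_Ico {n k l s m : ℕ} (hk : 1 ≤ k) (hl : 1 ≤ l) {a x : ℤ}
    (hx : (n : ℤ) ∣ x - (k - l) * a)
    (hlow : (l : ℤ) * (m - 1) + (l - 1) * s < x)
    (hhigh : x + (k * (m - 1) + (k - 1) * s) < n) :
    SumFree {0, (s : ZMod n)} k l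
      ((Finset.Ico a (a + m)).image (Int.cast : ℤ → ZMod n)) := by
  have hA : ∀ y ∈ (Finset.Ico a (a + m)).image (Int.cast : ℤ → ZMod n),
      ∃ x : ℤ, a ≤ x ∧ x ≤ a + m - 1 ∧ (x : ZMod n) = y := by
    intro y hy
    obtain ⟨x, hx, rfl⟩ := Finset.mem_image.1 hy
    rw [Finset.mem_Ico] at hx
    exact ⟨x, hx.1, by omega, rfl⟩
  rw [SumFree, Finset.eq_empty_iff_forall_notMem]
  intro y hy
  rw [Finset.mem_inter] at hy
  obtain ⟨u, hau, hub, rfl⟩ := exists_lift_of_mem_noisy s hA hk y hy.1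
  obtain ⟨v, hav, hvb, huv⟩ := exists_lift_of_mem_noisy s hA hl _ hy.2
  have hdvd := (ZMod.intCast_eq_intCast_iff_dvd_sub v u n).1 huv
  have hdvd' := dvd_add hdvd hx
  have hpos : 0 < u - v + (x - (k - l) * a) := by linarith
  have := Int.le_of_dvd hpos hdvd'
  linarith

/-- Every multiple of `gcd(n, d)` is congruent modulo `n` to a multiple of `d`. -/
theorem exists_dvd_sub_mul_of_gcd_dvd {n d x : ℤ} (hx : (Int.gcd n d : ℤ) ∣ x) :
    ∃ a : ℤ, n ∣ x - d * a := by
  obtain ⟨t, rfl⟩ := hx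
  refine ⟨Int.gcdB n d * t, Int.gcdA n d * t, ?_⟩
  rw [Int.gcd_eq_gcd_ab]
  ring

theorem stmt9 (n : ℕ) [NeZero n] (k l s : ℕ) (hl : 1 ≤ l) (hkl : l < k) (hs : 1 ≤ s)
    (δ r : ℤ) (hδ : δ = Int.gcd (n : ℤ) ((k : ℤ) - (l : ℤ)))
    (hr : r = (-(k : ℤ) * (((n : ℤ) + 2 * ((s : ℤ) - 1)) / ((k : ℤ) + (l : ℤ)))
        + ((s : ℤ) - 1)) % δ) :
    ∃ A : Finset (ZMod n),
      SumFree ({0, (s : ZMod n)} : Finset (ZMod n)) k l A ∧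
      ((n : ℤ) + 2 * ((s : ℤ) - 1) - r) / ((k : ℤ) + (l : ℤ)) - ((s : ℤ) - 1)
        ≤ (A.card : ℤ) := by
  have hk : 1 ≤ k := hl.trans hkl.le
  set S : ℤ := (s : ℤ) - 1 with hS
  set N : ℤ := (n : ℤ) + 2 * S with hN
  set M : ℤ := (N - r) / ((k : ℤ) + l)
  rcases le_or_gt (M - S) 0 with hneg | hpos
  · exact ⟨∅, sumFree_empty _ l hk, by simpa using hneg⟩
  have hδpos : 0 < δ := by
    rw [hδ]
    exact_mod_cast Int.gcd_pos_of_ne_zero_left _ (by exact_mod_cast NeZero.ne n)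
  have hδle : δ ≤ (k : ℤ) - l := by
    rw [hδ]
    exact Int.le_of_dvd (by omega) (Int.gcd_dvd_right _ _)
  have hδn : δ ∣ (n : ℤ) := hδ ▸ Int.gcd_dvd_left _ _
  have hr0 : 0 ≤ r := hr ▸ Int.emod_nonneg _ hδpos.ne'
  have hrδ : r < δ := hr ▸ Int.emod_lt_of_pos _ hδpos
  have hS0 : 0 ≤ S := by omega
  have hkl0 : (0 : ℤ) < (k : ℤ) + l := by omega
  have hMle : M * ((k : ℤ) + l) ≤ N - r := Int.ediv_mul_le _ hkl0.ne'
  set Q : ℤ := N / ((k : ℤ) + l)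
  have hQle : Q * ((k : ℤ) + l) ≤ N := Int.ediv_mul_le _ hkl0.ne'
  have hMQ : M ≤ Q := Int.ediv_le_ediv hkl0 (by linarith)
  -- a multiple of `δ` in the admissible window `[1 + l * M - s, n - 1 + s - k * M]`
  obtain ⟨x, hδx, hlow, hhigh⟩ :
      ∃ x : ℤ, δ ∣ x ∧ l * M - s < x ∧ x + (k * M - s) < n := by
    rcases hMQ.eq_or_lt with hEq | hlt
    · refine ⟨n + (-(k : ℤ) * Q + S - r), dvd_add hδn ?_, ?_, ?_⟩
      · rw [hr]
        exact Int.dvd_self_sub_emod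
      · rw [← hEq]
        linarith
      · rw [← hEq]
        linarith
    · set y : ℤ := n + s - 1 - k * M with hy
      have hy0 := Int.emod_nonneg y hδpos.ne'
      have hyδ := Int.emod_lt_of_pos y hδpos
      have hstep : (M + 1) * ((k : ℤ) + l) ≤ N :=
        (mul_le_mul_of_nonneg_right (by omega) hkl0.le).trans hQle
      refine ⟨y - y % δ, Int.dvd_self_sub_emod, ?_, ?_⟩
      · linarith
      · linarith
  obtain ⟨a, ha⟩ := exists_dvd_sub_mul_of_gcd_dvd (hδ ▸ hδx)
  obtain ⟨m, hm⟩ := Int.eq_ofNat_of_zero_le hpos.le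
  have hm' : (m : ℤ) = M - s + 1 := by omega
  have hmn : m ≤ n := by
    have hle_mul : (m : ℤ) ≤ m * ((k : ℤ) + l) := le_mul_of_one_le_right (by positivity) (by omega)
    have hS_mul : S * 2 ≤ S * ((k : ℤ) + l) := mul_le_mul_of_nonneg_left (by omega) hS0
    have hm_mul : (m : ℤ) * ((k : ℤ) + l) = M * ((k : ℤ) + l) - S * ((k : ℤ) + l) := by
      rw [hm', hS]
      ring
    zify
    linarith
  refine ⟨(Finset.Ico a (a + m)).image Int.cast, sumFree_image_Ico hk hl ha ?_ ?_, ?_⟩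
  · rw [hm']
    linarith
  · rw [hm']
    linarith
  · rw [card_image_intCast_Ico a hmn]
    exact hm.le
end

section
/- Let n ≥ 1, let k > ℓ ≥ 1 be integers, let s ≥ 1 be an integer, and let d = gcd(s, n). Let A ⊆ ZMod n be {0,s}-(k,ℓ)-sum-free (with {0,s} the image of {0, s} ⊆ ℤ in ZMod n), and let K = stab(k *_{{0,s}} A). If the cyclic subgroup of ZMod n generated by d is not contained in K (equivalently, the image of s in ZMod n does not lie in K), then |A| ≤ ⌊n/(k+ℓ)⌋. -/
open Finset Pointwise

section Sumsets

variable {G : Type*} [AddCommGroup G] [DecidableEq G]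

/-- Scherk's theorem: if `0 = 0 + 0` is the only representation of `0` in `A + B`, then
`|A + B| ≥ |A| + |B| - 1`. -/
theorem card_add_card_le_of_unique_zero (A B : Finset G) (hA : 0 ∈ A) (hB : 0 ∈ B)
    (huniq : ∀ a ∈ A, ∀ b ∈ B, a + b = 0 → b = 0) :
    #A + #B ≤ #(A + B) + 1 := by
  induction hm : #B using Nat.strong_induction_on generalizing A B with
  | _ m ih =>
    by_cases hsub : A + B ⊆ A
    · have hB0 : B ⊆ {0} := by
        intro b hb
        have himg : A.image (· + b) = A := by
          refine eq_of_subset_of_card_le ?_ ?_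
          · intro x hx
            obtain ⟨a, ha, rfl⟩ := mem_image.1 hx
            exact hsub (add_mem_add ha hb)
          · rw [card_image_of_injective _ (add_left_injective b)]
        obtain ⟨a, ha, hab⟩ := mem_image.1 (himg.symm ▸ hA)
        exact mem_singleton.2 (huniq a ha b hb hab)
      have hBcard : #B ≤ 1 := by simpa using card_le_card hB0
      have hAcard : #A ≤ #(A + B) := card_le_card (subset_add_left A hB)
      omega
    · obtain ⟨x, hx, hxA⟩ := not_subset.1 hsub
      obtain ⟨e, he, b₀, hb₀, rfl⟩ := mem_add.1 hx
      set A' := A ∪ B.image (e + ·) with hA'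
      set B' := B.filter (fun b => e + b ∈ A) with hB'
      have hlt : #B' < #B := card_lt_card
        ⟨filter_subset _ _, fun h => hxA (mem_filter.1 (h hb₀)).2⟩
      have hcard : #A' + #B' = #A + #B := by
        have hinter : A ∩ B.image (e + ·) = B'.image (e + ·) := by
          ext y
          simp only [hB', mem_inter, mem_image, mem_filter]
          constructor
          · rintro ⟨hy, b, hb, rfl⟩
            exact ⟨b, ⟨hb, hy⟩, rfl⟩
          · rintro ⟨b, ⟨hb, hy⟩, rfl⟩
            exact ⟨hy, b, hb, rfl⟩
        have h := card_union_add_card_inter A (B.image (e + ·))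
        rwa [hinter, card_image_of_injective _ (add_right_injective e),
          card_image_of_injective _ (add_right_injective e)] at h
      have hsum : A' + B' ⊆ A + B := by
        intro y hy
        obtain ⟨a, ha, b, hb, rfl⟩ := mem_add.1 hy
        obtain ⟨hb, hbA⟩ := mem_filter.1 hb
        rcases mem_union.1 ha with ha | ha
        · exact add_mem_add ha hb
        · obtain ⟨c, hc, rfl⟩ := mem_image.1 ha
          rw [add_right_comm]
          exact add_mem_add hbA hc
      have hrec := ih #B' (hm ▸ hlt) A' B' (mem_union_left _ hA)
        (mem_filter.2 ⟨hB, by simpa using he⟩) (by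
          intro a ha b hb hab
          obtain ⟨hb, hbA⟩ := mem_filter.1 hb
          rcases mem_union.1 ha with ha | ha
          · exact huniq a ha b hb hab
          · obtain ⟨c, hc, rfl⟩ := mem_image.1 ha
            have hc0 : c = 0 := huniq _ hbA c hc (by rw [add_right_comm]; exact hab)
            subst hc0
            exact huniq e he b hb (by simpa using hab)) rfl
      have := card_le_card hsum
      omega

/-- If `A + B + {0, s}` is not invariant under translation by `s`, it has at least `|A| + |B|`
elements. -/
theorem card_add_card_le_card_add_pair (A B : Finset G) (s : G)
    (h : s +ᵥ (A + B + {0, s}) ≠ A + B + {0, s}) :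
    #A + #B ≤ #(A + B + {0, s}) := by
  set T := A + B + {0, s} with hT
  have hnot : ¬ s +ᵥ T ⊆ T := fun hsub =>
    h (eq_of_subset_of_card_le hsub (card_vadd_finset s T).ge)
  obtain ⟨y, hy, hyT⟩ := not_subset.1 hnot
  obtain ⟨z, hz, rfl⟩ := mem_vadd_finset.1 hy
  rw [vadd_eq_add] at hyT
  obtain ⟨w, hw, c, hc, rfl⟩ := mem_add.1 hz
  have hcs : c = s := by
    rcases mem_insert.1 hc with rfl | hc
    · refine absurd ?_ hyT
      rw [add_zero, add_comm]
      exact add_mem_add hw (by simp)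
    · exact mem_singleton.1 hc
  subst hcs
  obtain ⟨a, ha, b, hb, rfl⟩ := mem_add.1 hw
  have hS : a + b + c ∉ A + B := fun hmem => hyT (by
    rw [add_comm c]
    exact add_mem_add hmem (by simp))
  have haA : a + c ∉ A := fun hmem => hS (by
    rw [add_right_comm]
    exact add_mem_add hmem hb)
  set A₁ := (-(a + c)) +ᵥ insert (a + c) A with hA₁
  set B₁ := (-b) +ᵥ B with hB₁
  have key := card_add_card_le_of_unique_zero A₁ B₁
    (mem_vadd_finset.2 ⟨a + c, mem_insert_self _ _, by simp⟩)
    (mem_vadd_finset.2 ⟨b, hb, by simp⟩) (by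
      intro x hx y hy hxy
      obtain ⟨x, hx', rfl⟩ := mem_vadd_finset.1 hx
      obtain ⟨y, hy', rfl⟩ := mem_vadd_finset.1 hy
      simp only [vadd_eq_add] at hxy ⊢
      rcases mem_insert.1 hx' with rfl | hx'
      · simpa using hxy
      · refine absurd ?_ hS
        have : a + b + c = x + y := by
          rw [← sub_eq_zero, ← neg_eq_zero, ← hxy]
          abel
        rw [this]
        exact add_mem_add hx' hy')
  have hsum : A₁ + B₁ = (-(a + c) + -b) +ᵥ (insert (a + c) A + B) := by
    rw [hA₁, hB₁, vadd_add_vadd_comm]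
  have hsub : insert (a + c) A + B ⊆ T := by
    intro y hy
    obtain ⟨x, hx, b', hb', rfl⟩ := mem_add.1 hy
    rcases mem_insert.1 hx with rfl | hx
    · rw [add_right_comm]
      exact add_mem_add (add_mem_add ha hb') (by simp)
    · rw [← add_zero (x + b')]
      exact add_mem_add (add_mem_add hx hb') (by simp)
  rw [hsum, hA₁, hB₁, card_vadd_finset, card_vadd_finset, card_vadd_finset,
    card_insert_of_notMem haA] at key
  have := card_le_card hsub
  omega

end Sumsets

theorem mem_stab_iff {n : ℕ} {X : Finset (ZMod n)} {g : ZMod n} :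
    g ∈ stab X ↔ g +ᵥ X = X :=
  Iff.rfl

theorem noisy_one {n : ℕ} (C A : Finset (ZMod n)) : noisy C 1 A = A := by
  simp only [noisy, iterSum, Nat.sub_self, singleton_zero, add_zero]

theorem noisy_add_two {n : ℕ} (C A : Finset (ZMod n)) (j : ℕ) :
    noisy C (j + 2) A = noisy C (j + 1) A + A + C := by
  simp only [noisy, iterSum, Nat.add_sub_cancel, show j + 2 - 1 = j + 1 from rfl]
  abel

theorem stab_noisy_mono {n : ℕ} (C A : Finset (ZMod n)) {j m : ℕ} (hj : 1 ≤ j) (hjm : j ≤ m) :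
    stab (noisy C j A) ⊆ stab (noisy C m A) := by
  induction m, hjm using Nat.le_induction with
  | base => exact subset_rfl
  | succ m hm ih =>
    obtain ⟨i, rfl⟩ := Nat.exists_eq_add_of_le' (hj.trans hm)
    intro g hg
    have hg' := mem_stab_iff.1 (ih hg)
    rw [mem_stab_iff, noisy_add_two, ← vadd_add_assoc, ← vadd_add_assoc, hg']

theorem mul_card_le_card_noisy {n : ℕ} (A : Finset (ZMod n)) (s : ZMod n) {j : ℕ} (hj : 1 ≤ j)
    (hs : s ∉ stab (noisy {0, s} j A)) : j * #A ≤ #(noisy {0, s} j A) := by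
  induction j, hj using Nat.le_induction with
  | base => simp [noisy_one]
  | succ j hj ih =>
    have hrec := ih fun h => hs (stab_noisy_mono _ A hj j.le_succ h)
    obtain ⟨i, rfl⟩ := Nat.exists_eq_add_of_le' hj
    rw [noisy_add_two] at hs ⊢
    have := card_add_card_le_card_add_pair _ A s fun h => hs (mem_stab_iff.2 h)
    rw [Nat.succ_mul]
    omega

theorem zmultiples_gcd_subset_stab {n : ℕ} (s : ℕ) (X : Finset (ZMod n))
    (hs : (s : ZMod n) ∈ stab X) :
    (AddSubgroup.zmultiples ((Nat.gcd s n : ℕ) : ZMod n) : Set (ZMod n)) ⊆ stab X := by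
  have hle : AddSubgroup.zmultiples ((Nat.gcd s n : ℕ) : ZMod n) ≤
      AddAction.stabilizer (ZMod n) X := by
    rw [AddSubgroup.zmultiples_le]
    have hgcd : ((Nat.gcd s n : ℕ) : ZMod n) = Nat.gcdA s n • (s : ZMod n) := by
      have h := congrArg (Int.cast : ℤ → ZMod n) (Nat.gcd_eq_gcd_ab s n)
      push_cast at h
      rw [h, ZMod.natCast_self, zero_mul, add_zero, zsmul_eq_mul, mul_comm]
    rw [hgcd]
    exact zsmul_mem (AddAction.mem_stabilizer_iff.2 (mem_stab_iff.1 hs)) _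
  exact fun g hg => mem_stab_iff.2 (AddAction.mem_stabilizer_iff.1 (hle hg))

theorem stmt10 (n : ℕ) [NeZero n] (k l s : ℕ) (hl : 1 ≤ l) (hkl : l < k) (hs : 1 ≤ s)
    (d : ℕ) (hd : d = Nat.gcd s n)
    (A : Finset (ZMod n))
    (hfree : SumFree ({0, (s : ZMod n)} : Finset (ZMod n)) k l A)
    (hK : ¬ ((AddSubgroup.zmultiples ((d : ZMod n)) : Set (ZMod n)) ⊆
        stab (noisy ({0, (s : ZMod n)} : Finset (ZMod n)) k A))) :
    A.card ≤ n / (k + l) := by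
  subst hd
  have hsX : (s : ZMod n) ∉ stab (noisy {0, (s : ZMod n)} k A) := fun h =>
    hK (zmultiples_gcd_subset_stab s _ h)
  have hX := mul_card_le_card_noisy A (s : ZMod n) (hl.trans hkl.le) hsX
  have hY := mul_card_le_card_noisy A (s : ZMod n) hl
    fun h => hsX (stab_noisy_mono _ A hl hkl.le h)
  have hdisj := card_union_of_disjoint (disjoint_iff_inter_eq_empty.2 hfree)
  have hle := card_le_univ (noisy {0, (s : ZMod n)} k A ∪ noisy {0, (s : ZMod n)} l A)
  rw [ZMod.card] at hle
  rw [Nat.le_div_iff_mul_le (by omega), mul_comm, add_mul]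
  omega
end

section
/- Let n ≥ 1, let k ≥ 1, let s ≥ 1 be an integer, and let A ⊆ ZMod n be a nonempty finite set. Suppose the image of s in ZMod n does not lie in K = stab(k *_{{0,s}} A), where {0,s} is the image of {0, s} ⊆ ℤ in ZMod n. Then for every j with 1 ≤ j ≤ k, |j *_{{0,s}} A| ≥ j·|A|. -/
open Finset Pointwise

/-- Splitting two distinct summands off a finite sum. -/
theorem sum_eq_add_add_sum_sdiff_pair {ι M : Type*} [Fintype ι] [DecidableEq ι]
    [AddCommMonoid M] (h : ι → M) {p q : ι} (hpq : p ≠ q) :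
    ∑ i, h i = h p + h q + ∑ i ∈ univ \ {p, q}, h i := by
  rw [← Finset.sum_pair hpq, add_comm, Finset.sum_sdiff (subset_univ _)]

section AddCommGroup

variable {G : Type*} [AddCommGroup G] [DecidableEq G]

/-- Repeated Dyson transforms turn a tuple of sets containing `0` into one in which every set
is invariant under adding the later ones, keeping the total size and not enlarging the sumset. -/
theorem exists_absorbing {m : ℕ} (f : Fin m → Finset G) (h0 : ∀ i, 0 ∈ f i) :
    ∃ g : Fin m → Finset G, (∀ i, 0 ∈ g i) ∧ ∑ i, g i ⊆ ∑ i, f i ∧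
      ∑ i, #(g i) = ∑ i, #(f i) ∧ ∀ p q, p < q → g p + g q ⊆ g p := by
  induction hN : ∑ i : Fin m, (i : ℕ) * #(f i) using Nat.strong_induction_on generalizing f with
  | _ N ih =>
  by_cases hf : ∀ p q, p < q → f p + f q ⊆ f p
  · exact ⟨f, h0, Subset.rfl, rfl, hf⟩
  push Not at hf
  obtain ⟨p, q, hpq, hnot⟩ := hf
  obtain ⟨z, hz, hzp⟩ := Finset.not_subset.1 hnot
  obtain ⟨x, hx, y, hy, rfl⟩ := Finset.mem_add.1 hz
  set P := f p ∪ (x +ᵥ f q)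
  set Q := f q ∩ (-x +ᵥ f p)
  have hcard : #P + #Q = #(f p) + #(f q) := addDysonETransform.card x (f p, f q)
  have hsub : P + Q ⊆ f p + f q := addDysonETransform.subset x (f p, f q)
  have hlt : #Q < #(f q) := by
    refine Finset.card_lt_card ⟨Finset.inter_subset_left, fun h => hzp ?_⟩
    have := (Finset.mem_inter.1 (h hy)).2
    rwa [← Finset.neg_vadd_mem_iff, neg_neg, vadd_eq_add] at this
  have hne : p ≠ q := hpq.ne
  set g : Fin m → Finset G := Function.update (Function.update f p P) q Q with hg
  have hgp : g p = P := by simp [hg, hne]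
  have hgq : g q = Q := by simp [hg]
  have hgi : ∀ i, i ≠ p → i ≠ q → g i = f i := fun i hip hiq => by simp [hg, hip, hiq]
  have hrest : ∀ i ∈ (univ \ {p, q} : Finset (Fin m)), g i = f i := fun i hi => by
    simp only [mem_sdiff, mem_univ, true_and, mem_insert, mem_singleton, not_or] at hi
    exact hgi i hi.1 hi.2
  have hg0 : ∀ i, 0 ∈ g i := by
    intro i
    by_cases hip : i = p
    · subst hip
      rw [hgp]
      exact Finset.mem_union_left _ (h0 _)
    by_cases hiq : i = q
    · subst hiq
      rw [hgq]
      refine Finset.mem_inter.2 ⟨h0 _, ?_⟩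
      rw [← Finset.neg_vadd_mem_iff, neg_neg, vadd_eq_add, add_zero]
      exact hx
    · rw [hgi i hip hiq]
      exact h0 i
  have hgsum : ∑ i, g i ⊆ ∑ i, f i := by
    rw [sum_eq_add_add_sum_sdiff_pair g hne, sum_eq_add_add_sum_sdiff_pair f hne,
      Finset.sum_congr rfl hrest, hgp, hgq]
    exact Finset.add_subset_add_right hsub
  have hgcard : ∑ i, #(g i) = ∑ i, #(f i) := by
    rw [sum_eq_add_add_sum_sdiff_pair (fun i => #(g i)) hne,
      sum_eq_add_add_sum_sdiff_pair (fun i => #(f i)) hne,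
      Finset.sum_congr rfl fun i hi => congrArg Finset.card (hrest i hi), hgp, hgq, hcard]
  have hweight : ∑ i : Fin m, (i : ℕ) * #(g i) < N := by
    rw [← hN, sum_eq_add_add_sum_sdiff_pair (fun i : Fin m => (i : ℕ) * #(g i)) hne,
      sum_eq_add_add_sum_sdiff_pair (fun i : Fin m => (i : ℕ) * #(f i)) hne,
      Finset.sum_congr rfl fun (i : Fin m) hi =>
        congrArg (fun B : Finset G => (i : ℕ) * #B) (hrest i hi), hgp, hgq]
    have : (p : ℕ) < q := hpq
    have : (p : ℕ) * #P + q * #Q < p * #(f p) + q * #(f q) := by nlinarith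
    omega
  obtain ⟨g', h1, h2, h3, h4⟩ := ih _ hweight g hg0 rfl
  exact ⟨g', h1, h2.trans hgsum, h3.trans hgcard, h4⟩

/-- If `B + C ⊆ B` with `B` finite, then `B` is also closed under subtracting elements of `C`. -/
theorem sub_mem_of_add_subset {B C : Finset G} (h : B + C ⊆ B) {b c : G} (hb : b ∈ B)
    (hc : c ∈ C) : b - c ∈ B := by
  have himg : B.image (· + c) = B := by
    refine Finset.eq_of_subset_of_card_le ?_ ?_
    · exact Finset.image_subset_iff.2 fun x hx => h (Finset.add_mem_add hx hc)
    · rw [Finset.card_image_of_injective _ (add_left_injective c)]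
  rw [← himg] at hb
  obtain ⟨x, hx, rfl⟩ := Finset.mem_image.1 hb
  simpa using hx

/-- If the sumset of `m` sets containing `0` avoids `s, 2s, …, (m - 1)s`, then adding the
progression `0, s, …, (m - 1)s` to it gives a set at least as large as the total size. -/
theorem sum_card_le_card_sum_add_progression {m : ℕ} (f : Fin m → Finset G)
    (h0 : ∀ i, 0 ∈ f i) (s : G) (hs : ∀ t : ℕ, 0 < t → t < m → t • s ∉ ∑ i, f i) :
    ∑ i, #(f i) ≤ #(∑ i, f i + (range m).image (· • s)) := by
  obtain ⟨g, hg0, hgsum, hgcard, hg⟩ := exists_absorbing f h0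
  have hgle : ∀ i, g i ⊆ ∑ i, f i := fun i => by
    refine Subset.trans ?_ hgsum
    rw [← Finset.add_sum_erase _ _ (mem_univ i)]
    refine Finset.subset_add_left _ ?_
    rw [← Finset.mem_coe, Finset.coe_sum]
    simpa using Set.finsetSum_mem_finsetSum (univ.erase i) (fun j => (g j : Set G))
      (fun _ => 0) fun j _ => hg0 j
  have hdisj : ∀ p q : Fin m, p < q →
      Disjoint ((p : ℕ) • s +ᵥ g p) ((q : ℕ) • s +ᵥ g q) := by
    intro p q hpq
    rw [Finset.disjoint_left]
    intro z hzp hzq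
    obtain ⟨b, hb, rfl⟩ := Finset.mem_vadd_finset.1 hzp
    obtain ⟨c, hc, hbc⟩ := Finset.mem_vadd_finset.1 hzq
    have hlt : (p : ℕ) < q := hpq
    refine hs ((q : ℕ) - p) (by omega) (by omega) (hgle p ?_)
    have : ((q : ℕ) - p) • s = b - c := by
      rw [sub_nsmul _ hlt.le]
      simp only [vadd_eq_add] at hbc
      rw [eq_sub_iff_add_eq, add_right_comm, hbc]
      abel
    rw [this]
    exact sub_mem_of_add_subset (hg p q hpq) hb hc
  rw [← hgcard]
  calc ∑ i, #(g i) = ∑ i : Fin m, #((i : ℕ) • s +ᵥ g i) := by simp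
    _ = #(univ.biUnion fun i : Fin m => (i : ℕ) • s +ᵥ g i) := by
      refine (Finset.card_biUnion fun p _ q _ hpq => ?_).symm
      rcases lt_or_gt_of_ne hpq with h | h
      · exact hdisj p q h
      · exact (hdisj q p h).symm
    _ ≤ _ := by
      refine Finset.card_le_card (Finset.biUnion_subset.2 fun i _ z hz => ?_)
      obtain ⟨b, hb, rfl⟩ := Finset.mem_vadd_finset.1 hz
      rw [vadd_eq_add, add_comm (_ • s)]
      exact Finset.add_mem_add (hgle i hb)
        (Finset.mem_image_of_mem _ (Finset.mem_range.2 i.isLt))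

/-- If some `d ∈ mA` has none of `d + s, …, d + (m - 1)s` in `mA`, then
`mA + {0, s, …, (m - 1)s}` has at least `m |A|` elements. -/
theorem mul_card_le_card_nsmul_add_progression {A : Finset G} {m : ℕ} {s d : G}
    (hd : d ∈ m • A) (hs : ∀ t : ℕ, 0 < t → t < m → d + t • s ∉ m • A) :
    m * #A ≤ #(m • A + (range m).image (· • s)) := by
  have hmA : m • A = ∑ _i : Fin m, A := by simp
  rw [hmA, ← Finset.mem_coe, Finset.coe_sum] at hd
  obtain ⟨a, ha, rfl⟩ := (Set.mem_fintype_sum _ _).1 hd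
  have hsum : ∑ i, ({-a i} + A) = {-∑ i, a i} + m • A := by
    rw [Finset.sum_add_distrib, ← hmA, ← Finset.sum_neg_distrib]
    congr 1
    exact (map_sum (Finset.singletonAddMonoidHom (α := G)) _ _).symm
  have key := sum_card_le_card_sum_add_progression (fun i => {-a i} + A) (s := s)
    (fun i => Finset.mem_add.2
      ⟨-a i, Finset.mem_singleton_self _, a i, ha i, neg_add_cancel _⟩) (fun t ht htm h => by
      rw [hsum] at h
      refine hs t ht htm ?_
      obtain ⟨x, hx, y, hy, hxy⟩ := Finset.mem_add.1 h
      rw [Finset.mem_singleton] at hx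
      rw [← hxy, hx, add_neg_cancel_left]
      exact hy)
  rw [hsum, add_assoc] at key
  simpa using key

end AddCommGroup

theorem iterSum_eq_nsmul {n : ℕ} (j : ℕ) (A : Finset (ZMod n)) : iterSum j A = j • A := by
  induction j with
  | zero => simp [iterSum, Finset.singleton_zero]
  | succ j ih => rw [iterSum, ih, succ_nsmul']

theorem iterSum_zero_pair {n : ℕ} (j : ℕ) (s : ZMod n) :
    iterSum j {0, s} = (range (j + 1)).image (· • s) := by
  induction j with
  | zero => simp [iterSum]
  | succ j ih =>
    rw [iterSum, ih]
    ext x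
    simp only [Finset.mem_add, Finset.mem_insert, Finset.mem_singleton, Finset.mem_image,
      Finset.mem_range]
    constructor
    · rintro ⟨_, rfl | rfl, _, ⟨t, ht, rfl⟩, rfl⟩
      · exact ⟨t, by omega, by simp⟩
      · exact ⟨t + 1, by omega, succ_nsmul' _ _⟩
    · rintro ⟨t, ht, rfl⟩
      rcases t with _ | t
      · exact ⟨0, Or.inl rfl, 0, ⟨0, by omega, by simp⟩, by simp⟩
      · exact ⟨s, Or.inr rfl, t • s, ⟨t, by omega, rfl⟩, (succ_nsmul' _ _).symm⟩

theorem noisy_zero_pair {n : ℕ} {k : ℕ} (hk : 1 ≤ k) (s : ZMod n) (A : Finset (ZMod n)) :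
    noisy {0, s} k A = k • A + (range k).image (· • s) := by
  rw [noisy, iterSum_eq_nsmul, iterSum_zero_pair, Nat.sub_add_cancel hk]

/-- If `s` does not stabilize `k *_{0,s} A`, then some `d ∈ kA` has none of
`d + s, …, d + ks` in `kA`. -/
theorem exists_mem_nsmul_of_notMem_stab {n : ℕ} {k : ℕ} (hk : 1 ≤ k) {s : ZMod n}
    {A : Finset (ZMod n)} (hK : s ∉ stab (noisy {0, s} k A)) :
    ∃ d ∈ k • A, ∀ t : ℕ, 0 < t → t ≤ k → d + t • s ∉ k • A := by
  rw [noisy_zero_pair hk] at hK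
  obtain ⟨c, hc, hcs⟩ : ∃ c ∈ k • A + (range k).image (· • s),
      s + c ∉ k • A + (range k).image (· • s) := by
    by_contra! h
    refine hK (Finset.eq_of_subset_of_card_le (Finset.image_subset_iff.2 h) ?_)
    rw [Finset.card_image_of_injective _ (add_right_injective s)]
  obtain ⟨d, hd, _, hrs, rfl⟩ := Finset.mem_add.1 hc
  obtain ⟨r, hr, rfl⟩ := Finset.mem_image.1 hrs
  rw [Finset.mem_range] at hr
  have hmem : ∀ y ∈ k • A, ∀ t < k, y + t • s ≠ s + (d + r • s) := fun y hy t ht h =>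
    hcs (h ▸ Finset.add_mem_add hy (Finset.mem_image_of_mem _ (Finset.mem_range.2 ht)))
  have hrk : r + 1 = k := by
    by_contra hne
    exact hmem d hd (r + 1) (by omega) (by rw [succ_nsmul]; abel)
  refine ⟨d, hd, fun t ht htk hy => hmem _ hy (k - t) (by omega) ?_⟩
  rw [add_assoc, ← add_nsmul, Nat.add_sub_cancel' htk, ← hrk, succ_nsmul]
  abel

theorem stmt11 (n : ℕ) [NeZero n] (k s : ℕ) (hk : 1 ≤ k) (hs : 1 ≤ s)
    (A : Finset (ZMod n)) (hA : A.Nonempty)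
    (hK : (s : ZMod n) ∉ stab (noisy ({0, (s : ZMod n)} : Finset (ZMod n)) k A))
    (j : ℕ) (hj1 : 1 ≤ j) (hjk : j ≤ k) :
    j * A.card ≤ (noisy ({0, (s : ZMod n)} : Finset (ZMod n)) j A).card := by
  obtain ⟨d, hd, hdk⟩ := exists_mem_nsmul_of_notMem_stab hk hK
  rw [← Nat.add_sub_cancel' hjk, add_nsmul] at hd hdk
  obtain ⟨x, hx, y, hy, rfl⟩ := Finset.mem_add.1 hd
  rw [noisy_zero_pair hj1]
  refine mul_card_le_card_nsmul_add_progression hx fun t ht htj h => ?_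
  refine hdk t ht (by omega) ?_
  rw [add_right_comm]
  exact Finset.add_mem_add h hy
end

section
/- Let n ≥ 1, let k > ℓ ≥ 1 be integers, let c ≥ 2, and let C ⊆ ZMod n be the image of {0, 1, ..., c-1}. Set δ = gcd(n, k-ℓ). Then there exists a C-(k,ℓ)-sum-free subset A of ZMod n that is an interval (the image in ZMod n of {a, a+1, ..., a+m-1} for some integers a and m) with (as integers) |A| ≥ ⌊(n + 2c - δ - 3)/(k+ℓ)⌋ - (c-2). -/
open Finset Pointwise

/-- Elements of the `j`-fold sum of an interval with `m + 1` terms starting at `a` have the form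
`j * a + t` with `0 ≤ t ≤ j * m`. -/
lemma exists_eq_of_mem_iterSum_interval {n : ℕ} (a : ℤ) (m j : ℕ) (x : ZMod n)
    (hx : x ∈ iterSum j ((range (m + 1)).image fun i : ℕ => (a : ZMod n) + (i : ZMod n))) :
    ∃ t : ℤ, 0 ≤ t ∧ t ≤ j * m ∧ x = ((j * a + t : ℤ) : ZMod n) := by
  induction j generalizing x with
  | zero => exact ⟨0, by simp, by simp, by simpa [iterSum] using hx⟩
  | succ j ih =>
    obtain ⟨y, hy, z, hz, rfl⟩ := mem_add.1 hx
    obtain ⟨i, hi, rfl⟩ := mem_image.1 hy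
    obtain ⟨t, ht0, ht, rfl⟩ := ih z hz
    have him : i ≤ m := Nat.lt_succ_iff.1 (mem_range.1 hi)
    refine ⟨i + t, by positivity, ?_, by push_cast; ring⟩
    push_cast
    linarith [(Int.ofNat_le.2 him : (i : ℤ) ≤ m)]

/-- Elements of the noisy `k`-fold sum of an interval with `m + 1` terms starting at `a`, with noise
`{0, ..., d}`, have the form `k * a + t` with `0 ≤ t ≤ k * m + (k - 1) * d`. -/
lemma exists_eq_of_mem_noisy_interval {n : ℕ} (a : ℤ) (m d k : ℕ) (hk : 1 ≤ k) (x : ZMod n)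
    (hx : x ∈ noisy ((range (d + 1)).image (Nat.cast : ℕ → ZMod n)) k
      ((range (m + 1)).image fun i : ℕ => (a : ZMod n) + (i : ZMod n))) :
    ∃ t : ℤ, 0 ≤ t ∧ t ≤ k * m + (k - 1) * d ∧ x = ((k * a + t : ℤ) : ZMod n) := by
  obtain ⟨y, hy, z, hz, rfl⟩ := mem_add.1 hx
  obtain ⟨s, hs0, hs, rfl⟩ := exists_eq_of_mem_iterSum_interval a m k y hy
  obtain ⟨t, ht0, ht, rfl⟩ := exists_eq_of_mem_iterSum_interval 0 d (k - 1) z (by simpa using hz)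
  rw [Nat.cast_sub hk, Nat.cast_one] at ht
  exact ⟨s + t, by positivity, by linarith, by push_cast; ring⟩

/-- An interval with `m + 1` terms starting at `a` is sum-free with respect to `{0, ..., d}` as soon
as `(k - l) * a` is congruent modulo `n` to some `r` far enough from both `0` and `n`. -/
lemma sumFree_interval {n k l m d : ℕ} (hk : 1 ≤ k) (hl : 1 ≤ l) (a r : ℤ)
    (har : (n : ℤ) ∣ (k - l) * a - r) (hlr : l * m + (l - 1) * d < r)
    (hrk : r + (k * m + (k - 1) * d) < n) :
    SumFree ((range (d + 1)).image (Nat.cast : ℕ → ZMod n)) k l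
      ((range (m + 1)).image fun i : ℕ => (a : ZMod n) + (i : ZMod n)) := by
  refine eq_empty_of_forall_notMem fun x hx => ?_
  obtain ⟨hxk, hxl⟩ := mem_inter.1 hx
  obtain ⟨s, hs0, hs, rfl⟩ := exists_eq_of_mem_noisy_interval a m d k hk x hxk
  obtain ⟨t, ht0, ht, hst⟩ := exists_eq_of_mem_noisy_interval a m d l hl _ hxl
  have hdvd := (ZMod.intCast_eq_intCast_iff_dvd_sub _ _ n).1 hst.symm
  have hn : (n : ℤ) ∣ r + s - t := by
    have h := dvd_sub hdvd har
    rwa [show (k * a + s - (l * a + t) - ((k - l) * a - r) : ℤ) = r + s - t by ring] at h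
  have := Int.le_of_dvd (by linarith) hn
  linarith

/-- An interval with at most `n` terms in `ZMod n` has no repeated terms. -/
lemma card_interval {n m : ℕ} (hm : m ≤ n) (a : ZMod n) :
    ((range m).image fun i : ℕ => a + (i : ZMod n)).card = m := by
  rw [card_image_of_injOn, card_range]
  intro i hi j hj hij
  have hi' : i < n := (mem_range.1 hi).trans_le hm
  have hj' : j < n := (mem_range.1 hj).trans_le hm
  have h := (ZMod.natCast_eq_natCast_iff' i j n).1 (add_left_cancel hij)
  rwa [Nat.mod_eq_of_lt hi', Nat.mod_eq_of_lt hj'] at h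

/-- Among any `gcd n b` consecutive integers, one is congruent to a multiple of `b` modulo `n`. -/
lemma exists_mul_congr_of_gcd (n b L : ℤ) (hn : n ≠ 0) :
    ∃ a r : ℤ, n ∣ b * a - r ∧ L < r ∧ r ≤ L + Int.gcd n b := by
  have hpos : (0 : ℤ) < Int.gcd n b := by exact_mod_cast Int.gcd_pos_of_ne_zero_left b hn
  set q := (L + Int.gcd n b) / Int.gcd n b
  refine ⟨Int.gcdB n b * q, Int.gcd n b * q, ⟨-Int.gcdA n b * q, ?_⟩, ?_, ?_⟩
  · linear_combination (-q) * Int.gcd_eq_gcd_ab n b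
  · linarith [Int.mul_ediv_add_emod (L + Int.gcd n b) (Int.gcd n b),
      Int.emod_lt_of_pos (L + Int.gcd n b) hpos]
  · exact Int.mul_ediv_self_le hpos.ne'

theorem stmt17 (n : ℕ) [NeZero n] (k l c : ℕ) (hl : 1 ≤ l) (hkl : l < k) (hc : 2 ≤ c)
    (C : Finset (ZMod n)) (hC : C = (Finset.range c).image (Nat.cast : ℕ → ZMod n))
    (δ : ℤ) (hδ : δ = Int.gcd (n : ℤ) ((k : ℤ) - (l : ℤ))) :
    ∃ (A : Finset (ZMod n)) (a : ℤ) (m : ℕ),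
      A = (Finset.range m).image (fun i : ℕ => (a : ZMod n) + (i : ZMod n)) ∧
      SumFree C k l A ∧
      ((n : ℤ) + 2 * (c : ℤ) - δ - 3) / ((k : ℤ) + (l : ℤ)) - ((c : ℤ) - 2)
        ≤ (A.card : ℤ) := by
  subst hC hδ
  obtain ⟨d, rfl⟩ : ∃ d, c = d + 1 := ⟨c - 1, by omega⟩
  set δ : ℤ := ((Int.gcd (n : ℤ) ((k : ℤ) - l) : ℕ) : ℤ)
  set F : ℤ := ((n : ℤ) + 2 * ((d + 1 : ℕ) : ℤ) - δ - 3) / ((k : ℤ) + l)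
  rcases le_or_gt (F - (((d + 1 : ℕ) : ℤ) - 2)) 0 with hneg | hpos
  · refine ⟨∅, 0, 0, by simp, ?_, by simpa using hneg⟩
    obtain ⟨j, rfl⟩ : ∃ j, k = j + 1 := ⟨k - 1, by omega⟩
    simp [SumFree, noisy, iterSum]
  · obtain ⟨m, hm⟩ : ∃ m : ℕ, F - (((d + 1 : ℕ) : ℤ) - 2) = m + 1 :=
      ⟨(F - (((d + 1 : ℕ) : ℤ) - 2) - 1).toNat, by omega⟩
    have hFle : ((k : ℤ) + l) * F ≤ (n : ℤ) + 2 * ((d + 1 : ℕ) : ℤ) - δ - 3 :=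
      Int.mul_ediv_self_le (by omega)
    rw [show F = m + d by push_cast at hm; linarith] at hFle
    push_cast at hFle
    obtain ⟨a, r, har, hlr, hrδ⟩ := exists_mul_congr_of_gcd n ((k : ℤ) - l)
      (l * m + (l - 1) * d) (by exact_mod_cast NeZero.ne n)
    have hrk : r + ((k : ℤ) * m + (k - 1) * d) < n := by linarith
    have hl' : (0 : ℤ) ≤ l - 1 := by omega
    have hk' : (0 : ℤ) ≤ k - 1 := by omega
    have hmn : m + 1 ≤ n := by
      zify
      nlinarith [mul_nonneg hl' (Nat.cast_nonneg (α := ℤ) d),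
        mul_nonneg hk' (Nat.cast_nonneg (α := ℤ) d),
        mul_nonneg hk' (Nat.cast_nonneg (α := ℤ) m),
        mul_nonneg (Nat.cast_nonneg (α := ℤ) l) (Nat.cast_nonneg (α := ℤ) m)]
    refine ⟨_, a, m + 1, rfl, sumFree_interval (by omega) hl a r har hlr hrk, ?_⟩
    rw [card_interval hmn, hm]
    push_cast
    rfl
end
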